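/- Let G be a graph with edge lengths ℓ and Dirichlet set V_D, and let v ∈ V ∖ V_D. Let G⁺ be the graph obtained from G by adding one new vertex w and one new edge e* with ι(e*) = v and τ(e*) = w, of length L > 0, and impose the Dirichlet condition at w. Then for every ω ∈ ℝ: det A_ω(G⁺, V_D ∪ {w}) = sin(Lω) · det A_ω(G, V_D) + cos(Lω) · det A_ω(G, V_D ∪ {v}). -/

import Mathlib

open Matrix Filter Topology

attribute [local instance] Classical.propDecidable

/-- The secular matrix built from per-edge cosine values `c` and sine values `s`,
for a graph with initial/terminal vertex maps `ι`, `τ` and Dirichlet vertex set `VD`.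
Rows and columns are indexed by `V ⊕ E × Bool`, where `(e, false)` plays the role of
`(e,0)` (initial endpoint data) and `(e, true)` of `(e,1)` (terminal endpoint data). -/
noncomputable def secMatrix {V E : Type} (ι τ : E → V) (VD : Set V)
    (c s : E → ℝ) : Matrix (V ⊕ E × Bool) (V ⊕ E × Bool) ℝ :=
  Matrix.of fun i j =>
    match i, j with
    | Sum.inl v, Sum.inl u =>
        if v ∈ VD then (if u = v then (1 : ℝ) else 0) else 0
    | Sum.inl v, Sum.inr (f, b) =>
        if v ∈ VD then 0
        else if b then (if τ f = v then 1 else 0) else (if ι f = v then 1 else 0)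
    | Sum.inr (e, b), Sum.inl u =>
        if b then (if u = ι e then s e else 0)
        else (if u = τ e then 1 else 0) + (if u = ι e then -(c e) else 0)
    | Sum.inr (e, b), Sum.inr (f, b') =>
        if b then
          (if f = e ∧ b' = false then c e else 0) + (if f = e ∧ b' = true then 1 else 0)
        else if f = e ∧ b' = false then s e else 0

/-- The secular matrix `A_ω(G, V_D)` of a metric graph with edge lengths `ℓ`. -/
noncomputable def secA {V E : Type} (ι τ : E → V) (VD : Set V) (ℓ : E → ℝ) (ω : ℝ) :
    Matrix (V ⊕ E × Bool) (V ⊕ E × Bool) ℝ :=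
  secMatrix ι τ VD (fun e => Real.cos (ℓ e * ω)) (fun e => Real.sin (ℓ e * ω))

/-- Two vertices are adjacent if some edge joins them (in either direction). -/
def GraphAdj {V E : Type} (ι τ : E → V) (u w : V) : Prop :=
  ∃ e : E, (ι e = u ∧ τ e = w) ∨ (ι e = w ∧ τ e = u)

/-- A graph is connected if any two vertices are joined by a walk. -/
def IsConnectedGraph {V E : Type} (ι τ : E → V) : Prop :=
  ∀ u w : V, Relation.ReflTransGen (GraphAdj ι τ) u w

/-- The degree of a vertex: the number of edges incident to it. -/
noncomputable def graphDegree {V E : Type} [Fintype E] (ι τ : E → V) (v : V) : ℕ :=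
  (Finset.univ.filter fun e => ι e = v ∨ τ e = v).card

/-- The determinant of a matrix `A` bordered by three rows and columns, standing for the new vertex
and the two ends of a pendant edge attached at `v`. -/
theorem det_fromBlocks_pendant {n : Type*} [Fintype n] [DecidableEq n] (A : Matrix n n ℝ) (v : n)
    (c s t : ℝ) :
    (fromBlocks A (of fun i => ![0, (Pi.single v 1 : n → ℝ) i, 0])
      (of ![0, Pi.single v (-c), Pi.single v t])
      !![1, 0, 0; 1, s, 0; 0, c, 1]).det =
      s * A.det + c * (A.updateRow v (Pi.single v 1)).det := by
  revert s
  rw [← funext_iff]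
  refine Continuous.ext_on (dense_compl_singleton (0 : ℝ)) ?_ (by fun_prop) ?_
  · refine Continuous.matrix_det (Continuous.matrix_fromBlocks (by fun_prop) (by fun_prop)
      (by fun_prop) ?_)
    refine continuous_matrix fun i j => ?_
    fin_cases i <;> fin_cases j <;> simp <;> fun_prop
  · intro s hs
    replace hs : s ≠ 0 := hs
    let D : Matrix (Fin 3) (Fin 3) ℝ := !![1, 0, 0; 1, s, 0; 0, c, 1]
    have hD : D.det = s := by simp [D, det_fin_three]
    let X : Matrix (Fin 3) n ℝ :=
      of ![0, Pi.single v (c / s), Pi.single v (-t - c * (c / s))]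
    have hX : of ![0, Pi.single v (-c), Pi.single v t] + D * X = 0 := by
      ext i j
      obtain rfl | hj := eq_or_ne j v
      · fin_cases i <;> simp [D, X] <;> field_simp <;> ring
      · fin_cases i <;> simp [D, X, hj]
    have hA : A + (of fun i => ![0, (Pi.single v 1 : n → ℝ) i, 0]) * X =
        A.updateRow v (A v + (c / s) • Pi.single v 1) := by
      ext i j
      obtain rfl | hi := eq_or_ne i v
      · obtain rfl | hj := eq_or_ne j i
        · simp [X, mul_apply, Fin.sum_univ_three]
        · simp [X, mul_apply, Fin.sum_univ_three, hj]
      · simp [X, mul_apply, Fin.sum_univ_three, hi]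
    have key := det_mul (fromBlocks A (of fun i => ![0, (Pi.single v 1 : n → ℝ) i, 0])
      (of ![0, Pi.single v (-c), Pi.single v t]) D) (fromBlocks 1 0 X 1)
    rw [fromBlocks_multiply] at key
    simp only [Matrix.mul_one, Matrix.mul_zero, zero_add, hX, hA, det_fromBlocks_zero₂₁,
      det_fromBlocks_zero₁₂, det_one, mul_one, hD, det_updateRow_add, det_updateRow_smul,
      updateRow_eq_self] at key
    change det (fromBlocks A _ _ D) = _
    rw [← key]
    field_simp

/-- Imposing a Dirichlet condition at `v` replaces the row of `v` by a standard basis vector. -/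
theorem secA_union_singleton {V E : Type} (ι τ : E → V) (VD : Set V) (v : V) (ℓ : E → ℝ) (ω : ℝ) :
    secA ι τ (VD ∪ {v}) ℓ ω =
      (secA ι τ VD ℓ ω).updateRow (Sum.inl v) (Pi.single (Sum.inl v) 1) := by
  ext i j
  rcases i with u | ⟨e, b⟩
  · obtain rfl | hu := eq_or_ne u v
    · rcases j with x | ⟨f, b'⟩ <;> simp [secA, secMatrix, Pi.single_apply]
    · rcases j with x | ⟨f, b'⟩ <;> simp [secA, secMatrix, hu]
  · rcases j with x | ⟨f, b'⟩ <;> simp [secA, secMatrix]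

/-- Splits off the indices created by a pendant edge: `0` is the new vertex, `1` and `2` are the
initial and terminal ends of the new edge. -/
def pendantIndexEquiv (V E : Type) :
    (V ⊕ E × Bool) ⊕ Fin 3 ≃ (V ⊕ Unit) ⊕ (E ⊕ Unit) × Bool where
  toFun
    | .inl (.inl u) => .inl (.inl u)
    | .inl (.inr (e, b)) => .inr (.inl e, b)
    | .inr 0 => .inl (.inr ())
    | .inr 1 => .inr (.inr (), false)
    | .inr 2 => .inr (.inr (), true)
  invFun
    | .inl (.inl u) => .inl (.inl u)
    | .inr (.inl e, b) => .inl (.inr (e, b))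
    | .inl (.inr _) => .inr 0
    | .inr (.inr _, false) => .inr 1
    | .inr (.inr _, true) => .inr 2
  left_inv := by
    rintro ((u | ⟨e, b⟩) | i)
    · rfl
    · rfl
    · fin_cases i <;> rfl
  right_inv := by
    rintro ((u | _) | ⟨e | _, _ | _⟩) <;> rfl

/-- The secular matrix after attaching a pendant Dirichlet edge, as a block matrix. -/
theorem secA_attach_pendant_submatrix {V E : Type} (ι τ : E → V) (ℓ : E → ℝ) (VD : Set V) (v : V)
    (hv : v ∉ VD) (L ω : ℝ) :
    (secA
      (Sum.elim (fun e : E => (Sum.inl (ι e) : V ⊕ Unit)) (fun _ : Unit => Sum.inl v))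
      (Sum.elim (fun e : E => (Sum.inl (τ e) : V ⊕ Unit)) (fun _ : Unit => Sum.inr ()))
      (Sum.inl '' VD ∪ {Sum.inr ()})
      (Sum.elim ℓ (fun _ : Unit => L)) ω).submatrix (pendantIndexEquiv V E)
        (pendantIndexEquiv V E) =
      fromBlocks (secA ι τ VD ℓ ω)
        (of fun i => ![0, (Pi.single (Sum.inl v) 1 : V ⊕ E × Bool → ℝ) i, 0])
        (of ![0, Pi.single (Sum.inl v) (-Real.cos (L * ω)),
          Pi.single (Sum.inl v) (Real.sin (L * ω))])
        !![1, 0, 0; 1, Real.sin (L * ω), 0; 0, Real.cos (L * ω), 1] := by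
  ext i j
  rcases i with (u | ⟨e, b⟩) | i <;> rcases j with (x | ⟨f, b'⟩) | j
  · simp [pendantIndexEquiv, secA, secMatrix]
  · simp [pendantIndexEquiv, secA, secMatrix]
  · obtain rfl | hu := eq_or_ne u v
    · fin_cases j <;> simp [pendantIndexEquiv, secA, secMatrix, hv]
    · fin_cases j <;> simp [pendantIndexEquiv, secA, secMatrix, hu, hu.symm]
  · simp [pendantIndexEquiv, secA, secMatrix]
  · simp [pendantIndexEquiv, secA, secMatrix]
  · fin_cases j <;> simp [pendantIndexEquiv, secA, secMatrix]
  · fin_cases i <;> simp [pendantIndexEquiv, secA, secMatrix, Pi.single_apply]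
  · fin_cases i <;> simp [pendantIndexEquiv, secA, secMatrix]
  · fin_cases i <;> fin_cases j <;> simp [pendantIndexEquiv, secA, secMatrix]

/-- Attaching a pendant edge of length `L` at a standard vertex `v`, with a Dirichlet
condition at the new vertex `Sum.inr ()`:
`det A_ω(G⁺, V_D ∪ {w}) = sin(Lω) det A_ω(G, V_D) + cos(Lω) det A_ω(G, V_D ∪ {v})`. -/
theorem det_secA_attach_pendant_dirichlet {V E : Type} [Fintype V] [Fintype E]
    (ι τ : E → V) (hnl : ∀ e, ι e ≠ τ e)
    (ℓ : E → ℝ) (hℓ : ∀ e, 0 < ℓ e)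
    (VD : Set V) (v : V) (hv : v ∉ VD) (L : ℝ) (hL : 0 < L) (ω : ℝ) :
    (secA
      (Sum.elim (fun e : E => (Sum.inl (ι e) : V ⊕ Unit)) (fun _ : Unit => Sum.inl v))
      (Sum.elim (fun e : E => (Sum.inl (τ e) : V ⊕ Unit)) (fun _ : Unit => Sum.inr ()))
      (Sum.inl '' VD ∪ {Sum.inr ()})
      (Sum.elim ℓ (fun _ : Unit => L)) ω).det
      = Real.sin (L * ω) * (secA ι τ VD ℓ ω).det
        + Real.cos (L * ω) * (secA ι τ (VD ∪ {v}) ℓ ω).det := by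
  rw [← det_submatrix_equiv_self (pendantIndexEquiv V E),
    secA_attach_pendant_submatrix ι τ ℓ VD v hv, det_fromBlocks_pendant, secA_union_singleton]
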